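/- Let A → R be a surjective local homomorphism of Noetherian local rings and let R → S be a scalar extension with S complete. Then there exists a Noetherian local ring B and a scalar extension A → B such that B ⊗_A R is isomorphic to S as an R-algebra. -/

import Mathlib

open IsLocalRing TensorProduct

universe u v w

/-- A local homomorphism `f : R → S` between local rings is a *scalar extension* if `S` is
faithfully flat as an `R`-module (via `f`) and `f` is unramified, i.e. the maximal ideal of `S`
is the extension of the maximal ideal of `R`. -/
def IsScalarExtension {R S : Type*} [CommRing R] [CommRing S] [IsLocalRing R] [IsLocalRing S]
    (f : R →+* S) : Prop :=
  (letI : Algebra R S := f.toAlgebra; Module.FaithfullyFlat R S) ∧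
    (maximalIdeal R).map f = maximalIdeal S

open Ideal

/-- A family generating an ideal `I` that stays linearly independent in `I / 𝔪 I`. -/
structure IsMinimalSystem {A : Type*} [CommRing A] [IsLocalRing A] (I : Ideal A) {k : ℕ}
    (a : Fin k → A) : Prop where
  span_eq : span (Set.range a) = I
  mem_of_sum_mem : ∀ u : Fin k → A, ∑ i, u i * a i ∈ maximalIdeal A * I → ∀ i, u i ∈ maximalIdeal A

theorem exists_isMinimalSystem {A : Type*} [CommRing A] [IsLocalRing A] [IsNoetherianRing A]
    (I : Ideal A) : ∃ (k : ℕ) (a : Fin k → A), IsMinimalSystem I a := by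
  classical
  have hex : ∃ k : ℕ, ∃ a : Fin k → A, span (Set.range a) = I := by
    obtain ⟨k, a, h⟩ := Submodule.fg_iff_exists_fin_generating_family.mp (IsNoetherian.noetherian I)
    exact ⟨k, a, h⟩
  obtain ⟨a, ha⟩ := Nat.find_spec hex
  have hmin := fun m => @Nat.find_min _ _ hex m
  generalize Nat.find hex = k at a hmin
  refine ⟨k, a, ha, fun u hu j => ?_⟩
  by_contra hj
  obtain _ | k := k
  · exact j.elim0
  refine hmin k (Nat.lt_succ_self k) ⟨a ∘ j.succAbove, ?_⟩
  have hle : span (Set.range (a ∘ j.succAbove)) ≤ I := by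
    rw [← ha]; exact span_mono (Set.range_comp_subset_range _ _)
  refine le_antisymm hle ?_
  refine Submodule.le_of_le_smul_of_le_jacobson_bot (I := maximalIdeal A)
    (IsNoetherian.noetherian I) (IsLocalRing.maximalIdeal_le_jacobson _) ?_
  rw [← ha, Ideal.span_le, ha]
  have hother : ∀ i, a (j.succAbove i) ∈
      span (Set.range (a ∘ j.succAbove)) ⊔ maximalIdeal A • I := fun i =>
    mem_sup_left (subset_span ⟨i, rfl⟩)
  rintro _ ⟨i, rfl⟩
  rcases Fin.eq_self_or_eq_succAbove j i with rfl | ⟨i, rfl⟩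
  swap
  · exact hother i
  have hunit : IsUnit (u i) := by simpa using hj
  rw [Fin.sum_univ_succAbove _ i] at hu
  have h2 : u i * a i ∈ span (Set.range (a ∘ i.succAbove)) ⊔ maximalIdeal A • I := by
    have := sub_mem (mem_sup_right hu : _ ∈ span (Set.range (a ∘ i.succAbove)) ⊔ _)
      (sum_mem fun l _ => Ideal.mul_mem_left _ (u (i.succAbove l)) (hother l) :
        ∑ l, u (i.succAbove l) * a (i.succAbove l) ∈ _)
    simpa using this
  exact (Ideal.unit_mul_mem_iff_mem _ hunit).mp h2

/-- Elementary form of flatness of `(C / J) / 𝔪 ^ n` over `A / 𝔪 ^ n` for all `n`: the canonical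
maps from `𝔪 ^ n / 𝔪 ^ (n + 1) ⊗ C / (J + 𝔪 C)` to the graded pieces of `C / J` are injective. -/
def IsFormallyFlat (A : Type*) {C : Type*} [CommRing A] [IsLocalRing A] [CommRing C] [Algebra A C]
    (J : Ideal C) : Prop :=
  ∀ (n k : ℕ) (a : Fin k → A), IsMinimalSystem (maximalIdeal A ^ n) a → ∀ c : Fin k → C,
    ∑ i, algebraMap A C (a i) * c i ∈ J ⊔ (maximalIdeal A).map (algebraMap A C) ^ (n + 1) →
      ∀ i, c i ∈ J ⊔ (maximalIdeal A).map (algebraMap A C)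

theorem mem_map_iff_exists_sum {A C : Type*} [CommRing A] [CommRing C] [Algebra A C]
    {I : Ideal A} {k : ℕ} {a : Fin k → A}
    (ha : span (Set.range a) = I) {x : C} :
    x ∈ I.map (algebraMap A C) ↔ ∃ c : Fin k → C, ∑ i, algebraMap A C (a i) * c i = x := by
  rw [← ha, Ideal.map_span, ← Set.range_comp, Ideal.mem_span_range_iff_exists_fun]
  simp [mul_comm]

section FormallyFlat

variable {A C : Type*} [CommRing A] [IsLocalRing A] [CommRing C] [Algebra A C]

theorem IsMinimalSystem.mem_sup_pow_iff {n k : ℕ} {a : Fin k → A}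
    (ha : IsMinimalSystem (maximalIdeal A ^ n) a) {J : Ideal C} {x : C} :
    x ∈ J ⊔ (maximalIdeal A).map (algebraMap A C) ^ n ↔
      ∃ c : Fin k → C, x - ∑ i, algebraMap A C (a i) * c i ∈ J := by
  rw [← Ideal.map_pow, Submodule.mem_sup]
  constructor
  · rintro ⟨y, hy, z, hz, rfl⟩
    obtain ⟨c, rfl⟩ := (mem_map_iff_exists_sum ha.span_eq).mp hz
    exact ⟨c, by simpa using hy⟩
  · rintro ⟨c, hc⟩
    exact ⟨_, hc, _, (mem_map_iff_exists_sum ha.span_eq).mpr ⟨c, rfl⟩, by ring⟩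

theorem isFormallyFlat_bot_of_flat [Module.Flat A C] [IsNoetherianRing A] :
    IsFormallyFlat A (⊥ : Ideal C) := by
  intro n k a ha c hc
  obtain ⟨l, b, hb⟩ := exists_isMinimalSystem (maximalIdeal A ^ (n + 1))
  obtain ⟨d, hd⟩ := hb.mem_sup_pow_iff.mp hc
  rw [Ideal.mem_bot, sub_eq_zero] at hd
  obtain ⟨κ, α, y, hy, hα⟩ := Module.Flat.isTrivialRelation_of_sum_smul_eq_zero (R := A) (M := C)
    (f := Sum.elim a fun j => -b j) (x := Sum.elim c d) (by
      simp [Fintype.sum_sum_type, Algebra.smul_def, hd])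
  intro i
  refine Ideal.mem_sup_right ?_
  have : c i = ∑ j, α (Sum.inl i) j • y j := hy (Sum.inl i)
  rw [this]
  refine sum_mem fun j _ => ?_
  rw [Algebra.smul_def]
  refine Ideal.mul_mem_right _ _ (Ideal.mem_map_of_mem _ ?_)
  refine ha.mem_of_sum_mem (fun i => α (Sum.inl i) j) ?_ i
  have h := hα j
  simp only [Fintype.sum_sum_type, Sum.elim_inl, Sum.elim_inr, neg_mul, Finset.sum_neg_distrib,
    ← sub_eq_add_neg, sub_eq_zero] at h
  rw [← pow_succ', ← hb.span_eq]
  simp only [mul_comm (α _ _)]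
  rw [h]
  exact sum_mem fun i _ => Ideal.mul_mem_right _ _ (subset_span ⟨i, rfl⟩)

/-- Formal flatness survives dividing by an element that is regular modulo `𝔪`. -/
theorem IsFormallyFlat.sup_span_singleton [IsNoetherianRing A] {J : Ideal C}
    (hJ : IsFormallyFlat A J) {f : C}
    (hf : ∀ c, f * c ∈ J ⊔ (maximalIdeal A).map (algebraMap A C) →
      c ∈ J ⊔ (maximalIdeal A).map (algebraMap A C)) :
    IsFormallyFlat A (J ⊔ span {f}) := by
  set M := (maximalIdeal A).map (algebraMap A C) with hM
  intro n k a ha c hc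
  obtain ⟨y, hy, z, hz, hyz⟩ := Submodule.mem_sup.mp hc
  obtain ⟨w, hw, v, hv, rfl⟩ := Submodule.mem_sup.mp hy
  obtain ⟨g, rfl⟩ := Ideal.mem_span_singleton'.mp hv
  have key : ∀ j, j ≤ n → g ∈ J ⊔ M ^ j := by
    intro j
    induction j with
    | zero => intro; simp
    | succ j ih =>
      intro hj
      obtain ⟨l, b, hb⟩ := exists_isMinimalSystem (maximalIdeal A ^ j)
      obtain ⟨e, he⟩ := hb.mem_sup_pow_iff.mp (ih (by lia))
      have hfg : f * g ∈ J ⊔ M ^ (j + 1) := by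
        have h1 : ∑ i, algebraMap A C (a i) * c i ∈ M ^ (j + 1) := by
          refine Ideal.pow_le_pow_right hj ?_
          rw [hM, ← Ideal.map_pow]
          exact (mem_map_iff_exists_sum ha.span_eq).mpr ⟨c, rfl⟩
        have h2 : z ∈ M ^ (j + 1) := Ideal.pow_le_pow_right (by lia) hz
        have : f * g = (∑ i, algebraMap A C (a i) * c i - z) - w := by
          rw [← hyz]; ring
        rw [this]
        exact sub_mem (Ideal.mem_sup_right (sub_mem h1 h2)) (Ideal.mem_sup_left hw)
      have h3 : ∑ i, algebraMap A C (b i) * (f * e i) ∈ J ⊔ M ^ (j + 1) := by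
        have : ∑ i, algebraMap A C (b i) * (f * e i) =
            f * g - f * (g - ∑ i, algebraMap A C (b i) * e i) := by
          rw [mul_sub, sub_sub_cancel, Finset.mul_sum]
          exact Finset.sum_congr rfl fun i _ => by ring
        rw [this]
        exact sub_mem hfg (Ideal.mem_sup_left (J.mul_mem_left _ he))
      have h4 := fun i => hf _ (hJ j l b hb _ h3 i)
      have h5 : ∑ i, algebraMap A C (b i) * e i ∈ J ⊔ M ^ (j + 1) := by
        refine sum_mem fun i _ => ?_
        obtain ⟨p, hp, q, hq, hpq⟩ := Submodule.mem_sup.mp (h4 i)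
        rw [← hpq, mul_add]
        refine add_mem (Ideal.mem_sup_left (J.mul_mem_left _ hp)) (Ideal.mem_sup_right ?_)
        rw [pow_succ]
        refine Ideal.mul_mem_mul ?_ hq
        rw [hM, ← Ideal.map_pow, ← hb.span_eq]
        exact Ideal.mem_map_of_mem _ (subset_span ⟨i, rfl⟩)
      simpa using add_mem (Ideal.mem_sup_left he : _ ∈ J ⊔ M ^ (j + 1)) h5
  obtain ⟨e, he⟩ := ha.mem_sup_pow_iff.mp (key n le_rfl)
  have h6 : ∑ i, algebraMap A C (a i) * (c i - f * e i) ∈ J ⊔ M ^ (n + 1) := by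
    have : ∑ i, algebraMap A C (a i) * (c i - f * e i) =
        w + f * (g - ∑ i, algebraMap A C (a i) * e i) + z := by
      have h7 : ∑ i, algebraMap A C (a i) * (f * e i) =
          f * ∑ i, algebraMap A C (a i) * e i := by
        rw [Finset.mul_sum]
        exact Finset.sum_congr rfl fun i _ => by ring
      simp only [mul_sub, Finset.sum_sub_distrib, h7, ← hyz]
      ring
    rw [this]
    exact add_mem (Ideal.mem_sup_left (add_mem hw (J.mul_mem_left _ he))) (Ideal.mem_sup_right hz)
  intro i
  have h8 := hJ n k a ha _ h6 i
  have h9 : f * e i ∈ J ⊔ span {f} ⊔ M :=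
    Ideal.mem_sup_left (Ideal.mem_sup_right (Ideal.mul_mem_right _ _ (mem_span_singleton_self f)))
  have h10 : J ⊔ M ≤ J ⊔ span {f} ⊔ M := sup_le_sup_right le_sup_left _
  simpa using add_mem (h10 h8) h9

theorem isFormallyFlat_sSup {𝒥 : Set (Ideal C)} (hne : 𝒥.Nonempty) (hdir : DirectedOn (· ≤ ·) 𝒥)
    (h : ∀ J ∈ 𝒥, IsFormallyFlat A J) : IsFormallyFlat A (sSup 𝒥) := by
  intro n k a ha c hc i
  obtain ⟨y, hy, z, hz, hyz⟩ := Submodule.mem_sup.mp hc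
  obtain ⟨J, hJ, hyJ⟩ := (Submodule.mem_sSup_of_directed hne hdir).mp hy
  refine sup_le_sup_right (le_sSup hJ) _ (h J hJ n k a ha c ?_ i)
  rw [← hyz]
  exact add_mem (Ideal.mem_sup_left hyJ) (Ideal.mem_sup_right hz)

theorem IsFormallyFlat.of_algHom {J : Ideal C} (hJ : IsFormallyFlat A J) {B : Type*} [CommRing B]
    [Algebra A B] (f : C →ₐ[A] B)
    (hmem : ∀ n x, f x ∈ (maximalIdeal A).map (algebraMap A B) ^ n →
      x ∈ J ⊔ (maximalIdeal A).map (algebraMap A C) ^ n)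
    (hsurj : ∀ b, ∃ x, b - f x ∈ (maximalIdeal A).map (algebraMap A B))
    (hle : J ≤ RingHom.ker f) : IsFormallyFlat A (⊥ : Ideal B) := by
  intro n k a ha b hb i
  rw [bot_sup_eq] at hb ⊢
  choose x hx using hsurj
  have hxb : ∑ i, algebraMap A C (a i) * x (b i) ∈
      J ⊔ (maximalIdeal A).map (algebraMap A C) ^ (n + 1) := by
    refine hmem _ _ ?_
    have h1 : f (∑ i, algebraMap A C (a i) * x (b i)) = ∑ i, algebraMap A B (a i) * b i -
        ∑ i, algebraMap A B (a i) * (b i - f (x (b i))) := by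
      simp [mul_sub]
    rw [h1]
    refine sub_mem hb (sum_mem fun j _ => ?_)
    rw [pow_succ, ← Ideal.map_pow]
    refine Ideal.mul_mem_mul (Ideal.mem_map_of_mem _ ?_) (hx _)
    rw [← ha.span_eq]
    exact subset_span ⟨j, rfl⟩
  have h2 : f (x (b i)) ∈ (maximalIdeal A).map (algebraMap A B) := by
    obtain ⟨y, hy, z, hz, hyz⟩ := Submodule.mem_sup.mp (hJ n k a ha _ hxb i)
    rw [← hyz, map_add, (RingHom.mem_ker).mp (hle hy), zero_add, ← f.comp_algebraMap,
      ← Ideal.map_map]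
    exact Ideal.mem_map_of_mem _ hz
  have := add_mem (hx (b i)) h2
  rwa [sub_add_cancel] at this

end FormallyFlat

section Noetherian

variable {B : Type*} [CommRing B]

theorem exists_maximal_not_fg (h : ¬ IsNoetherianRing B) :
    ∃ p : Ideal B, Maximal (fun J : Ideal B => ¬ J.FG) p := by
  rw [isNoetherianRing_iff_ideal_fg] at h
  push Not at h
  obtain ⟨J₀, hJ₀⟩ := h
  have hchain : ∀ c ⊆ {J : Ideal B | ¬ J.FG}, IsChain (· ≤ ·) c → ∀ J ∈ c,
      ∃ ub ∈ {J : Ideal B | ¬ J.FG}, ∀ z ∈ c, z ≤ ub := by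
    refine fun c hc hchain J hJ => ⟨sSup c, ?_, fun _ => le_sSup⟩
    rintro ⟨G, hG⟩
    obtain ⟨J', hJ', hGJ⟩ : ∃ J' ∈ c, (G : Set B) ⊆ J' := by
      refine hchain.directedOn.exists_mem_subset_of_finset_subset_biUnion ⟨J, hJ⟩ fun x hx => ?_
      simp only [Set.mem_iUnion, SetLike.mem_coe, exists_prop]
      exact (Submodule.mem_sSup_of_directed ⟨J, hJ⟩ hchain.directedOn).1 (hG ▸ subset_span hx)
    have : J' = sSup c := le_antisymm (le_sSup hJ') (hG ▸ Ideal.span_le.2 hGJ)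
    exact hc hJ' (this ▸ ⟨G, hG⟩)
  obtain ⟨p, -, hp⟩ := zorn_le_nonempty₀ _ hchain J₀ hJ₀
  exact ⟨p, hp⟩

/-- Successive approximation: in an `I`-adically complete ring an ideal `p` with
`p ≤ N + x p` for some `x ∈ I` and a finitely generated ideal `N` is contained in `N`. -/
theorem le_span_range_of_forall_exists (I : Ideal B) [IsAdicComplete I B] {x : B} (hx : x ∈ I)
    {p : Ideal B} {k : ℕ} (a : Fin k → B)
    (h : ∀ y ∈ p, ∃ c : Fin k → B, ∃ z ∈ p, y = ∑ i, c i * a i + x * z) :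
    p ≤ span (Set.range a) := by
  choose! c z hz hyz using h
  intro y hy
  let Y : ℕ → B := fun n => z^[n] y
  have hY : ∀ n, Y n ∈ p := by
    intro n
    induction n with
    | zero => exact hy
    | succ n ih => simpa only [Y, Function.iterate_succ_apply'] using hz _ ih
  have hYs : ∀ n, Y n = ∑ i, c (Y n) i * a i + x * Y (n + 1) := fun n => by
    simpa only [Y, Function.iterate_succ_apply'] using hyz _ (hY n)
  let P : Fin k → ℕ → B := fun i n => ∑ j ∈ Finset.range n, x ^ j * c (Y j) i
  have hP : ∀ n, y = ∑ i, P i n * a i + x ^ n * Y n := by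
    intro n
    induction n with
    | zero => simp [P, Y]
    | succ n ih =>
      nth_rewrite 1 [ih, hYs n]
      simp only [P, Finset.sum_range_succ, add_mul, Finset.sum_add_distrib, mul_add,
        Finset.mul_sum, pow_succ, mul_assoc, add_assoc]
  have hlim : ∀ i, ∃ L, ∀ n, P i n ≡ L [SMOD I ^ n • (⊤ : Submodule B B)] := by
    intro i
    refine IsPrecomplete.prec inferInstance fun {m n} hmn => ?_
    rw [SModEq.comm, SModEq.sub_mem, smul_eq_mul, Ideal.mul_top]
    simp only [P]
    rw [← Finset.sum_range_add_sum_Ico _ hmn, add_sub_cancel_left]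
    refine sum_mem fun j hj => Ideal.mul_mem_right _ _ ?_
    exact Ideal.pow_le_pow_right (Finset.mem_Ico.mp hj).1 (Ideal.pow_mem_pow hx j)
  choose L hL using hlim
  have hfin : y - ∑ i, L i * a i = 0 := by
    refine IsHausdorff.haus (I := I) inferInstance _ fun n => ?_
    rw [SModEq.zero, smul_eq_mul, Ideal.mul_top]
    have : y - ∑ i, L i * a i = ∑ i, (P i n - L i) * a i + x ^ n * Y n := by
      nth_rewrite 1 [hP n]
      simp only [sub_mul, Finset.sum_sub_distrib]
      ring
    rw [this]
    refine add_mem (sum_mem fun i _ => Ideal.mul_mem_right _ _ ?_)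
      (Ideal.mul_mem_right _ _ (Ideal.pow_mem_pow hx n))
    have := SModEq.sub_mem.mp (hL i n)
    rwa [smul_eq_mul, Ideal.mul_top] at this
  rw [sub_eq_zero.mp hfin]
  exact sum_mem fun i _ => Ideal.mul_mem_left _ _ (subset_span ⟨i, rfl⟩)

/-- A ring that is complete with respect to a finitely generated ideal `I` is Noetherian as soon
as its quotient by `I` is. -/
theorem isNoetherianRing_of_isAdicComplete (I : Ideal B) (hI : I.FG) [IsAdicComplete I B]
    [IsNoetherianRing (B ⧸ I)] : IsNoetherianRing B := by
  classical
  by_contra hB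
  obtain ⟨p, hp⟩ := exists_maximal_not_fg hB
  have hprime : p.IsPrime := isOka_fg.isPrime_of_maximal_not hp
  by_cases hIp : I ≤ p
  · refine hp.prop (fg_of_fg_map_of_fg_inf_ker_of_surjective (f := Ideal.Quotient.mk I)
      (IsNoetherian.noetherian _) ?_ Ideal.Quotient.mk_surjective)
    rwa [Ideal.mk_ker, inf_eq_right.mpr hIp]
  obtain ⟨x, hxI, hxp⟩ := SetLike.not_le_iff_exists.mp hIp
  have hfg : (span ((p : Set B) ∪ {x})).FG := by
    by_contra hfg
    have := hp.le_of_ge hfg (fun y hy => subset_span (Or.inl hy))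
    exact hxp (this (subset_span (Or.inr rfl)))
  obtain ⟨s, hs, hspan⟩ := (Submodule.fg_span_iff_fg_span_finset_subset _).mp hfg
  have hsp : ((s.erase x : Finset B) : Set B) ⊆ p := by
    intro y hy
    rw [Finset.coe_erase] at hy
    exact (hs hy.1).resolve_right hy.2
  obtain ⟨k, a, ha⟩ := Submodule.fg_iff_exists_fin_generating_family.mp
    (⟨s.erase x, rfl⟩ : (span ((s.erase x : Finset B) : Set B)).FG)
  replace ha : span (Set.range a) = span ((s.erase x : Finset B) : Set B) := ha
  have hle : p ≤ span (Set.range a) := by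
    refine le_span_range_of_forall_exists I hxI a fun y hy => ?_
    have hy' : y ∈ span (Set.range a) ⊔ span {x} := by
      rw [ha, ← Ideal.span_union]
      have h1 : y ∈ span (s : Set B) := by
        have : y ∈ span ((p : Set B) ∪ {x}) := subset_span (Or.inl hy)
        rwa [show span ((p : Set B) ∪ {x}) = span (s : Set B) from hspan] at this
      refine span_mono ?_ h1
      intro t ht
      by_cases htx : t = x
      · exact Or.inr htx
      · exact Or.inl (by simpa using ⟨ht, htx⟩)
    obtain ⟨u, hu, v, hv, rfl⟩ := Submodule.mem_sup.mp hy'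
    obtain ⟨c, rfl⟩ := Ideal.mem_span_range_iff_exists_fun.mp hu
    obtain ⟨z, rfl⟩ := Ideal.mem_span_singleton'.mp hv
    refine ⟨c, z, ?_, by ring⟩
    have hup : ∑ i, c i * a i ∈ p := by
      rw [ha] at hu
      exact (Ideal.span_le.mpr hsp) hu
    exact (hprime.mem_or_mem ((Submodule.add_mem_iff_right _ hup).mp hy)).resolve_right hxp
  refine hp.prop ?_
  rw [le_antisymm hle (ha ▸ Ideal.span_le.mpr hsp), ha]
  exact ⟨_, rfl⟩

end Noetherian

section Flat

variable {A B : Type*} [CommRing A] [IsLocalRing A] [CommRing B] [Algebra A B]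

theorem smul_top_eq_restrictScalars_pow (n : ℕ) :
    maximalIdeal A ^ n • (⊤ : Submodule A B) =
      ((maximalIdeal A).map (algebraMap A B) ^ n).restrictScalars A := by
  rw [Ideal.smul_top_eq_map, Ideal.map_pow]

variable (A) in
/-- Lifts to `B` of a basis of `B / 𝔪 B` over the residue field of `A`. -/
theorem exists_lift_basis (B : Type w) [CommRing B] [Algebra A B] : ∃ (Λ : Type w) (e : Λ → B),
    Submodule.span A (Set.range e) ⊔ maximalIdeal A • ⊤ = ⊤ ∧
    ∀ (s : Finset Λ) (u : Λ → A), ∑ i ∈ s, u i • e i ∈ maximalIdeal A • (⊤ : Submodule A B) →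
      ∀ i ∈ s, u i ∈ maximalIdeal A := by
  let _ : Field (A ⧸ maximalIdeal A) := Ideal.Quotient.field _
  let b := Module.Basis.ofVectorSpace (A ⧸ maximalIdeal A)
    (B ⧸ (maximalIdeal A • ⊤ : Submodule A B))
  choose e he using fun i => Submodule.mkQ_surjective (maximalIdeal A • ⊤ : Submodule A B) (b i)
  refine ⟨_, e, ?_, fun s u hu i hi => ?_⟩
  · rw [sup_comm, ← Submodule.map_mkQ_eq_top, Submodule.map_span, ← Set.range_comp]
    have h1 : (Submodule.mkQ (maximalIdeal A • ⊤ : Submodule A B)) ∘ e = b := funext he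
    rw [h1]
    have h2 := Submodule.restrictScalars_span A (A ⧸ maximalIdeal A) Ideal.Quotient.mk_surjective
      (Set.range b)
    rw [← h2, b.span_eq, Submodule.restrictScalars_top]
  · have h1 := linearIndependent_iff'.mp b.linearIndependent s
      (fun i => Ideal.Quotient.mk (maximalIdeal A) (u i)) ?_ i hi
    · exact Ideal.Quotient.eq_zero_iff_mem.mp h1
    · have h3 := (Submodule.Quotient.mk_eq_zero _).mpr hu
      rw [← Submodule.mkQ_apply, map_sum] at h3
      rw [← h3]
      refine Finset.sum_congr rfl fun i _ => ?_
      rw [map_smul, he]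
      rfl

theorem span_sup_pow_smul_eq_top {Λ : Type*} {e : Λ → B}
    (h : Submodule.span A (Set.range e) ⊔ maximalIdeal A • ⊤ = ⊤) (n : ℕ) :
    Submodule.span A (Set.range e) ⊔ maximalIdeal A ^ n • ⊤ = ⊤ := by
  induction n with
  | zero => rw [pow_zero, Ideal.one_eq_top, Submodule.top_smul, sup_top_eq]
  | succ n ih =>
    refine eq_top_iff.mpr (ih.symm.le.trans ?_)
    rw [pow_succ]
    refine sup_le le_sup_left ?_
    calc maximalIdeal A ^ n • ⊤
        = maximalIdeal A ^ n • (Submodule.span A (Set.range e) ⊔ maximalIdeal A • ⊤) := by rw [h]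
      _ = maximalIdeal A ^ n • Submodule.span A (Set.range e) ⊔
          (maximalIdeal A ^ n * maximalIdeal A) • ⊤ := by
        rw [Submodule.smul_sup, Submodule.mul_smul]
      _ ≤ _ := sup_le_sup_right Submodule.smul_le_right _

theorem IsFormallyFlat.mem_pow_of_sum_mem [IsNoetherianRing A]
    (hB : IsFormallyFlat A (⊥ : Ideal B)) {Λ : Type*} {e : Λ → B}
    (h : ∀ (s : Finset Λ) (u : Λ → A), ∑ i ∈ s, u i • e i ∈ maximalIdeal A • (⊤ : Submodule A B) →
      ∀ i ∈ s, u i ∈ maximalIdeal A) (n : ℕ) (s : Finset Λ) (u : Λ → A)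
    (hu : ∑ i ∈ s, u i • e i ∈ maximalIdeal A ^ n • (⊤ : Submodule A B)) :
    ∀ i ∈ s, u i ∈ maximalIdeal A ^ n := by
  induction n with
  | zero => simp
  | succ n ih =>
    obtain ⟨k, a, ha⟩ := exists_isMinimalSystem (maximalIdeal A ^ n)
    have h1 := ih (Submodule.smul_mono_left (Ideal.pow_le_pow_right n.le_succ) hu)
    have h2 : ∀ i : Λ, ∃ v : Fin k → A, i ∈ s → ∑ j, v j * a j = u i := by
      intro i
      by_cases hi : i ∈ s
      · have := h1 i hi
        rw [← ha.span_eq] at this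
        obtain ⟨v, hv⟩ := Ideal.mem_span_range_iff_exists_fun.mp this
        exact ⟨v, fun _ => hv⟩
      · exact ⟨0, fun h => (hi h).elim⟩
    choose v hv using h2
    have h3 : ∑ j, algebraMap A B (a j) * ∑ i ∈ s, v i j • e i = ∑ i ∈ s, u i • e i := by
      simp only [Finset.mul_sum]
      rw [Finset.sum_comm]
      refine Finset.sum_congr rfl fun i hi => ?_
      rw [← hv i hi, Finset.sum_smul]
      refine Finset.sum_congr rfl fun j _ => ?_
      rw [mul_comm (v i j), mul_smul, Algebra.smul_def (a j)]
    rw [smul_top_eq_restrictScalars_pow, ← h3] at hu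
    have h4 := hB n k a ha _ (Ideal.mem_sup_right hu)
    intro i hi
    rw [← hv i hi, pow_succ']
    refine sum_mem fun j _ => Ideal.mul_mem_mul ?_ ?_
    · refine h s (fun i => v i j) ?_ i hi
      have h5 := smul_top_eq_restrictScalars_pow (A := A) (B := B) 1
      rw [pow_one, pow_one] at h5
      rw [h5]
      simpa using h4 j
    · rw [← ha.span_eq]
      exact subset_span ⟨j, rfl⟩

/-- A uniform Artin-Rees statement for relations between finitely many ring elements. -/
theorem exists_forall_dotProduct_mem_pow [IsNoetherianRing A] {l : ℕ} (f : Fin l → A) (n : ℕ) :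
    ∃ N ≥ n, ∀ u : Fin l → A, ∑ i, f i * u i ∈ maximalIdeal A ^ N →
      ∃ v : Fin l → A, (∀ i, v i ∈ maximalIdeal A ^ n) ∧ ∑ i, f i * v i = ∑ i, f i * u i := by
  obtain ⟨k, hk⟩ := Ideal.exists_pow_inf_eq_pow_smul (maximalIdeal A) (span (Set.range f))
  refine ⟨n + k, Nat.le_add_right _ _, fun u hu => ?_⟩
  have h1 : ∑ i, f i * u i ∈ maximalIdeal A ^ n • span (Set.range f) := by
    have h2 : ∑ i, f i * u i ∈ maximalIdeal A ^ (n + k) • ⊤ ⊓ span (Set.range f) := by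
      refine ⟨by simpa using hu, sum_mem fun i _ => Ideal.mul_mem_right _ _ (subset_span ⟨i, rfl⟩)⟩
    rw [hk _ (Nat.le_add_left _ _), Nat.add_sub_cancel] at h2
    exact Submodule.smul_mono le_rfl inf_le_right h2
  obtain ⟨v, hv, hvu⟩ := (Submodule.mem_ideal_smul_span_iff_exists_sum _ _ _).mp h1
  refine ⟨v, hv, ?_⟩
  rw [← hvu, Finsupp.sum_fintype _ _ (by simp)]
  exact Finset.sum_congr rfl fun i _ => mul_comm _ _

/-- A Noetherian local algebra with flat associated graded ring is flat. -/
theorem IsFormallyFlat.flat [IsNoetherianRing A] [IsNoetherianRing B] [IsLocalRing B]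
    (hB : IsFormallyFlat A (⊥ : Ideal B)) (hne : (maximalIdeal A).map (algebraMap A B) ≠ ⊤) :
    Module.Flat A B := by
  classical
  obtain ⟨Λ, e, htop, hind⟩ := exists_lift_basis A B
  rw [Module.Flat.iff_forall_isTrivialRelation (R := A) (M := B)]
  intro l f x hfx
  let M := (maximalIdeal A).map (algebraMap A B)
  let T : Submodule B (Fin l → B) := Submodule.span B
    {y | ∃ v : Fin l → A, ∑ i, f i * v i = 0 ∧ y = fun i => algebraMap A B (v i)}
  have hT : x ∈ T := by
    rw [← Submodule.Quotient.mk_eq_zero, ← Submodule.mem_bot B,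
      ← Ideal.iInf_pow_smul_eq_bot_of_isLocalRing M hne, Submodule.mem_iInf]
    intro n
    obtain ⟨N, hN, hNf⟩ := exists_forall_dotProduct_mem_pow f n
    have hex : ∀ i, ∃ β : Λ →₀ A, ∃ z ∈ M ^ N, x i = (β.sum fun j a => a • e j) + z := by
      intro i
      have : x i ∈ Submodule.span A (Set.range e) ⊔ maximalIdeal A ^ N • ⊤ := by
        rw [span_sup_pow_smul_eq_top htop]; trivial
      obtain ⟨y, hy, z, hz, hyz⟩ := Submodule.mem_sup.mp this
      rw [smul_top_eq_restrictScalars_pow] at hz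
      obtain ⟨β, rfl⟩ := Finsupp.mem_span_range_iff_exists_finsupp.mp hy
      exact ⟨β, z, hz, hyz.symm⟩
    choose β z hz hx using hex
    let s : Finset Λ := Finset.univ.biUnion fun i => (β i).support
    have hs : ∀ i, x i = ∑ j ∈ s, β i j • e j + z i := by
      intro i
      rw [hx i, Finsupp.sum_of_support_subset (s := s) _ _ _ (by simp)]
      exact Finset.subset_biUnion_of_mem (fun i => (β i).support) (Finset.mem_univ i)
    have hsum : ∑ j ∈ s, (∑ i, f i * β i j) • e j = - ∑ i, f i • z i := by
      rw [eq_neg_iff_add_eq_zero, ← hfx]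
      simp only [Finset.sum_smul, mul_smul]
      rw [Finset.sum_comm, ← Finset.sum_add_distrib]
      refine Finset.sum_congr rfl fun i _ => ?_
      rw [hs i, smul_add, Finset.smul_sum]
    have hmem := hB.mem_pow_of_sum_mem hind N s (fun j => ∑ i, f i * β i j) (by
      rw [hsum, smul_top_eq_restrictScalars_pow]
      exact neg_mem (sum_mem fun i _ => Submodule.smul_mem _ _ (hz i)))
    have hγ : ∀ j, ∃ v : Fin l → A, j ∈ s → (∀ i, v i ∈ maximalIdeal A ^ n) ∧
        ∑ i, f i * v i = ∑ i, f i * β i j := by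
      intro j
      by_cases hj : j ∈ s
      · obtain ⟨v, hv⟩ := hNf _ (hmem j hj)
        exact ⟨v, fun _ => hv⟩
      · exact ⟨0, fun h => (hj h).elim⟩
    choose γ hγ using hγ
    have hx1 : x = ∑ j ∈ s, e j • (fun i => algebraMap A B (β i j - γ j i)) +
        fun i => ∑ j ∈ s, γ j i • e j + z i := by
      funext i
      rw [hs i]
      simp only [Pi.add_apply, Finset.sum_apply, Pi.smul_apply, smul_eq_mul, ← add_assoc]
      rw [← Finset.sum_add_distrib]
      congr 1
      refine Finset.sum_congr rfl fun j _ => ?_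
      rw [Algebra.smul_def, Algebra.smul_def, map_sub]
      ring
    have hx2 : ∑ j ∈ s, e j • (fun i => algebraMap A B (β i j - γ j i)) ∈ T := by
      refine sum_mem fun j hj => T.smul_mem _ (Submodule.subset_span ⟨_, ?_, rfl⟩)
      simp only [mul_sub, Finset.sum_sub_distrib]
      rw [(hγ j hj).2, sub_self]
    rw [hx1, Submodule.Quotient.mk_add, (Submodule.Quotient.mk_eq_zero T).mpr hx2, zero_add,
      ← Submodule.mkQ_apply, pi_eq_sum_univ' (fun i => _ + z i), map_sum]
    refine sum_mem fun i _ => ?_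
    rw [map_smul]
    refine Submodule.smul_mem_smul
      (add_mem (sum_mem fun j hj => ?_) (Ideal.pow_le_pow_right hN (hz i))) trivial
    rw [Algebra.smul_def, ← Ideal.map_pow]
    exact Ideal.mul_mem_right _ _ (Ideal.mem_map_of_mem _ ((hγ j hj).1 i))
  obtain ⟨k, y, a, hya⟩ := Submodule.mem_span_set'.mp hT
  choose v hv hav using fun j => (a j).2
  refine ⟨k, fun i j => v j i, y, fun i => ?_, fun j => hv j⟩
  rw [← hya, Finset.sum_apply]
  refine Finset.sum_congr rfl fun j _ => ?_
  rw [Pi.smul_apply, hav j, smul_eq_mul, Algebra.smul_def, mul_comm]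

end Flat

section RelationIdeal

variable {A : Type*} [CommRing A] {l : Type*} [Field l]

/-- The kernel of a map from `E[X]` to a field is, up to denominators in `E`, generated by
constants and one more element. -/
theorem exists_forall_C_mul_mem_sup_span {E : Type*} [CommRing E] (π : Polynomial E →+* l) :
    ∃ F, π F = 0 ∧ ∀ G, π G = 0 → ∃ u : E, π (Polynomial.C u) ≠ 0 ∧
      Polynomial.C u * G ∈ (RingHom.ker (π.comp Polynomial.C)).map Polynomial.C ⊔ span {F} := by
  classical
  set I₀ := (RingHom.ker (π.comp Polynomial.C)).map Polynomial.C with hI₀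
  by_cases hI : ∀ G, π G = 0 → G ∈ I₀
  · exact ⟨0, map_zero _, fun G hG => ⟨1, by simp, by simpa using hI G hG⟩⟩
  push Not at hI
  have hI₀π : ∀ G ∈ I₀, π G = 0 := by
    have : I₀ ≤ RingHom.ker π := Ideal.map_le_iff_le_comap.mpr fun _ h => h
    exact this
  have hex : ∃ d F, π F = 0 ∧ F ∉ I₀ ∧ Polynomial.natDegree F = d :=
    hI.imp' Polynomial.natDegree fun F hF => ⟨F, hF.1, hF.2, rfl⟩
  obtain ⟨F, hF, hFI, hFd⟩ := Nat.find_spec hex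
  have hmin : ∀ G, π G = 0 → G.natDegree < F.natDegree → G ∈ I₀ := by
    intro G hG hlt
    by_contra hGI
    exact Nat.find_min hex (hFd ▸ hlt) ⟨G, hG, hGI, rfl⟩
  have hlead : π (Polynomial.C F.leadingCoeff) ≠ 0 := by
    intro h0
    have h1 : Polynomial.C F.leadingCoeff * Polynomial.X ^ F.natDegree ∈ I₀ :=
      Ideal.mul_mem_right _ _ (Ideal.mem_map_of_mem _ h0)
    have h2 := F.eraseLead_add_C_mul_X_pow
    by_cases hd : F.natDegree = 0
    · rw [Polynomial.eq_C_of_natDegree_eq_zero hd] at hFI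
      refine hFI (Ideal.mem_map_of_mem _ ?_)
      rwa [Polynomial.leadingCoeff, hd] at h0
    · have h3 : F.eraseLead ∈ I₀ := by
        refine hmin _ ?_ ?_
        · rw [← h2, map_add, hI₀π _ h1, add_zero] at hF
          exact hF
        · have := F.eraseLead_natDegree_le
          omega
      exact hFI (h2 ▸ add_mem h3 h1)
  refine ⟨F, hF, fun G hG => ?_⟩
  induction hn : G.natDegree using Nat.strong_induction_on generalizing G with
  | _ n ih =>
    by_cases hlt : G.natDegree < F.natDegree
    · exact ⟨1, by simp, by simpa using Ideal.mem_sup_left (hmin G hG hlt)⟩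
    push Not at hlt
    let G' := Polynomial.C F.leadingCoeff * G -
      Polynomial.C G.leadingCoeff * Polynomial.X ^ (G.natDegree - F.natDegree) * F
    have hG' : π G' = 0 := by simp [G', hF, hG]
    have key : ∃ u : E, π (Polynomial.C u) ≠ 0 ∧ Polynomial.C u * G' ∈ I₀ ⊔ span {F} := by
      by_cases h0 : G.natDegree = 0
      · refine ⟨1, by simp, ?_⟩
        have : G' = 0 := by
          have hF0 : F.natDegree = 0 := by omega
          simp only [G', h0, hF0, Polynomial.leadingCoeff]
          conv_lhs =>
            rw [Polynomial.eq_C_of_natDegree_eq_zero h0, Polynomial.eq_C_of_natDegree_eq_zero hF0]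
          simp [mul_comm]
        simp [this]
      refine ih G'.natDegree ?_ G' hG' rfl
      rw [← hn]
      refine lt_of_le_of_ne ?_ ?_
      · refine (Polynomial.natDegree_sub_le _ _).trans (max_le ?_ ?_)
        · exact Polynomial.natDegree_C_mul_le _ _
        · refine Polynomial.natDegree_mul_le.trans ?_
          have := Polynomial.natDegree_C_mul_X_pow_le G.leadingCoeff (G.natDegree - F.natDegree)
          omega
      · intro heq
        have h1 : G'.coeff G.natDegree = 0 := by
          have h2 : (Polynomial.X ^ (G.natDegree - F.natDegree) * F).coeff G.natDegree =
              F.leadingCoeff := by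
            rw [Polynomial.coeff_X_pow_mul', if_pos (Nat.sub_le _ _),
              Nat.sub_sub_self hlt]
            rfl
          simp only [G', mul_assoc, Polynomial.coeff_sub, Polynomial.coeff_C_mul]
          rw [h2, Polynomial.leadingCoeff, Polynomial.leadingCoeff]
          ring
        rw [← heq] at h1
        have h3 := Polynomial.leadingCoeff_eq_zero.mp h1
        rw [h3] at heq
        exact h0 (by simpa using heq.symm)
    obtain ⟨u, hu, huG⟩ := key
    refine ⟨u * F.leadingCoeff, by simpa using ⟨hu, by simpa using hlead⟩, ?_⟩
    have h4 : Polynomial.C (u * F.leadingCoeff) * G = Polynomial.C u * G' +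
        Polynomial.C u * (Polynomial.C G.leadingCoeff *
          Polynomial.X ^ (G.natDegree - F.natDegree)) * F := by
      simp only [G', map_mul]
      ring
    rw [h4]
    exact add_mem huG (Ideal.mem_sup_right (Ideal.mul_mem_left _ _ (subset_span rfl)))

variable {σ : Type*} (π : MvPolynomial σ A →+* l)

/-- The ideal generated by those polynomials in the kernel of `π` that only involve the
variables in `W`. -/
noncomputable def relationIdeal (W : Set σ) : Ideal (MvPolynomial σ A) :=
  span {p | p ∈ MvPolynomial.supported A W ∧ π p = 0}

theorem relationIdeal_mono {W W' : Set σ} (h : W ⊆ W') :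
    relationIdeal π W ≤ relationIdeal π W' :=
  span_mono fun _ hp => ⟨MvPolynomial.supported_mono h hp.1, hp.2⟩

theorem relationIdeal_le_ker (W : Set σ) : relationIdeal π W ≤ RingHom.ker π :=
  Ideal.span_le.mpr fun _ hp => hp.2

theorem relationIdeal_univ : relationIdeal π Set.univ = RingHom.ker π :=
  le_antisymm (relationIdeal_le_ker π _) fun _ hp => subset_span ⟨by simp, hp⟩

theorem relationIdeal_empty :
    relationIdeal π ∅ = (RingHom.ker (π.comp MvPolynomial.C)).map MvPolynomial.C := by
  rw [relationIdeal, Ideal.map]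
  congr 1
  ext p
  simp only [MvPolynomial.supported_empty, Set.mem_ofPred_eq, Algebra.mem_bot, Set.mem_range,
    Set.mem_image, SetLike.mem_coe, RingHom.mem_ker]
  constructor
  · rintro ⟨⟨a, rfl⟩, h⟩
    exact ⟨a, h, rfl⟩
  · rintro ⟨a, h, rfl⟩
    exact ⟨⟨a, rfl⟩, h⟩

theorem relationIdeal_sUnion {𝒲 : Set (Set σ)} (hne : 𝒲.Nonempty)
    (hdir : DirectedOn (· ⊆ ·) 𝒲) :
    relationIdeal π (⋃₀ 𝒲) = sSup (relationIdeal π '' 𝒲) := by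
  refine le_antisymm (Ideal.span_le.mpr fun p hp => ?_) (sSup_le ?_)
  · have h1 : ((p.vars : Finset σ) : Set σ) ⊆ ⋃₀ 𝒲 := MvPolynomial.mem_supported.mp hp.1
    rw [Set.sUnion_eq_biUnion] at h1
    obtain ⟨W, hW, hpW⟩ := DirectedOn.exists_mem_subset_of_finset_subset_biUnion hne hdir h1
    exact (le_sSup (Set.mem_image_of_mem (relationIdeal π) hW) :
      relationIdeal π W ≤ _) (subset_span ⟨MvPolynomial.mem_supported.mpr hpW, hp.2⟩)
  · rintro _ ⟨W, hW, rfl⟩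
    exact relationIdeal_mono π (Set.subset_sUnion_of_mem hW)

theorem isPrime_relationIdeal (W : Set σ) : (relationIdeal π W).IsPrime := by
  classical
  have := (π.comp MvPolynomial.C).domain_nontrivial
  let E := MvPolynomial.supported A W
  let ev : E →+* l := π.comp E.val.toRingHom
  let θ : MvPolynomial σ A →+* MvPolynomial σ l :=
    MvPolynomial.eval₂Hom (MvPolynomial.C.comp (π.comp MvPolynomial.C)) fun i =>
      if i ∈ W then MvPolynomial.C (π (MvPolynomial.X i)) else MvPolynomial.X i
  let j : MvPolynomial ↥Wᶜ E →ₐ[E] MvPolynomial σ A :=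
    MvPolynomial.aeval fun i => MvPolynomial.X i.1
  have hE : ∀ p ∈ MvPolynomial.supported A W, θ p = MvPolynomial.C (π p) := by
    intro p hp
    rw [MvPolynomial.supported] at hp
    induction hp using Algebra.adjoin_induction with
    | mem x hx =>
      obtain ⟨i, hi, rfl⟩ := hx
      simp [θ, hi]
    | algebraMap r =>
      simp [θ, MvPolynomial.algebraMap_eq]
    | add x y _ _ hx hy => simp [hx, hy]
    | mul x y _ _ hx hy => simp [hx, hy]
  have hj : Function.Surjective j := by
    intro p
    have : (⊤ : Subalgebra A (MvPolynomial σ A)) ≤ j.range.restrictScalars A := by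
      rw [← MvPolynomial.adjoin_range_X, Algebra.adjoin_le_iff]
      rintro _ ⟨i, rfl⟩
      by_cases hi : i ∈ W
      · exact ⟨MvPolynomial.C ⟨MvPolynomial.X i, MvPolynomial.X_mem_supported.mpr hi⟩, by
          simp only [j, AlgHom.toRingHom_eq_coe, RingHom.coe_coe, MvPolynomial.aeval_C]; rfl⟩
      · exact ⟨MvPolynomial.X ⟨i, hi⟩, by simp [j]⟩
    exact this (Algebra.mem_top (x := p))
  have hθj : θ.comp j.toRingHom =
      (MvPolynomial.rename Subtype.val).toRingHom.comp (MvPolynomial.map ev) := by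
    refine MvPolynomial.ringHom_ext (fun p => ?_) fun i => ?_
    · simpa [j, ev] using hE p.1 p.2
    · have : (i : σ) ∉ W := i.2
      simp [j, θ, this]
  have hker : relationIdeal π W = RingHom.ker θ := by
    refine le_antisymm (Ideal.span_le.mpr fun p hp => ?_) fun p hp => ?_
    · rw [SetLike.mem_coe, RingHom.mem_ker, hE p hp.1, hp.2, map_zero]
    · obtain ⟨q, rfl⟩ := hj p
      have h1 : MvPolynomial.map ev q = 0 := by
        refine MvPolynomial.rename_injective _ Subtype.val_injective ?_
        rw [map_zero]
        exact (RingHom.congr_fun hθj q).symm.trans hp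
      rw [← RingHom.mem_ker, MvPolynomial.ker_map] at h1
      have h2 : (RingHom.ker ev).map MvPolynomial.C ≤ (relationIdeal π W).comap j.toRingHom := by
        refine Ideal.map_le_iff_le_comap.mpr fun e he => subset_span ?_
        have : j.toRingHom (MvPolynomial.C e) = e.1 := by simp [j]
        rw [this]
        exact ⟨e.2, he⟩
      exact h2 h1
  rw [hker]
  exact RingHom.ker_isPrime θ

theorem exists_forall_mul_mem_relationIdeal_sup (W : Set σ) (s : σ) :
    ∃ f ∈ relationIdeal π (insert s W), ∀ g ∈ relationIdeal π (insert s W), ∃ u, π u ≠ 0 ∧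
      u * g ∈ relationIdeal π W ⊔ span {f} := by
  classical
  have := (π.comp MvPolynomial.C).domain_nontrivial
  let E := MvPolynomial.supported A W
  let j : Polynomial E →ₐ[E] MvPolynomial σ A := Polynomial.aeval (MvPolynomial.X s)
  have hWE : ∀ e : E, (e : MvPolynomial σ A) ∈ MvPolynomial.supported A (insert s W) :=
    fun e => MvPolynomial.supported_mono (Set.subset_insert s W) e.2
  have hjC : ∀ e : E, j (Polynomial.C e) = e := fun e => Polynomial.aeval_C _ _
  have hj : ∀ p, j p ∈ MvPolynomial.supported A (insert s W) := by
    intro p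
    induction p using Polynomial.induction_on' with
    | add p q hp hq => rw [map_add]; exact add_mem hp hq
    | monomial n e =>
      rw [← Polynomial.C_mul_X_pow_eq_monomial, map_mul, hjC, map_pow]
      refine mul_mem (hWE e) (pow_mem ?_ n)
      simp only [j, Polynomial.aeval_X]
      exact MvPolynomial.X_mem_supported.mpr (Set.mem_insert s W)
  have hsurj : ∀ p ∈ MvPolynomial.supported A (insert s W), ∃ q, j q = p := by
    have : MvPolynomial.supported A (insert s W) ≤ j.range.restrictScalars A := by
      rw [MvPolynomial.supported, Algebra.adjoin_le_iff]
      rintro _ ⟨i, hi, rfl⟩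
      rcases hi with rfl | hi
      · exact ⟨Polynomial.X, by simp [j]⟩
      · exact ⟨Polynomial.C ⟨MvPolynomial.X i, MvPolynomial.X_mem_supported.mpr hi⟩, hjC _⟩
    exact this
  obtain ⟨F, hF, hFG⟩ := exists_forall_C_mul_mem_sup_span (π.comp j.toRingHom)
  refine ⟨j F, subset_span ⟨hj F, hF⟩, fun g hg => ?_⟩
  have hle : (RingHom.ker ((π.comp j.toRingHom).comp Polynomial.C)).map Polynomial.C ⊔ span {F} ≤
      (relationIdeal π W ⊔ span {j F}).comap j.toRingHom := by
    refine sup_le (Ideal.map_le_iff_le_comap.mpr fun e he => ?_) ?_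
    · refine Ideal.mem_sup_left (subset_span ?_)
      have : j.toRingHom (Polynomial.C e) = e.1 := hjC e
      rw [this]
      refine ⟨e.2, ?_⟩
      rw [← this]
      exact he
    · rw [Ideal.span_singleton_le_iff_mem]
      exact Ideal.mem_sup_right (subset_span rfl)
  induction hg using Submodule.span_induction with
  | mem g hg =>
    obtain ⟨G, rfl⟩ := hsurj g hg.1
    obtain ⟨u, hu, huG⟩ := hFG G hg.2
    exact ⟨j (Polynomial.C u), hu, by simpa using hle huG⟩
  | zero => exact ⟨1, by simp, by simp⟩
  | add x y _ _ hx hy =>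
    obtain ⟨u, hu, hux⟩ := hx
    obtain ⟨v, hv, hvy⟩ := hy
    refine ⟨u * v, by simp [hu, hv], ?_⟩
    rw [show u * v * (x + y) = v * (u * x) + u * (v * y) by ring]
    exact add_mem (Ideal.mul_mem_left _ _ hux) (Ideal.mul_mem_left _ _ hvy)
  | smul a x _ hx =>
    obtain ⟨u, hu, hux⟩ := hx
    refine ⟨u, hu, ?_⟩
    rw [smul_eq_mul, mul_left_comm]
    exact Ideal.mul_mem_left _ _ hux

end RelationIdeal

section Presentation

/-- Adding generators one at a time, transfinitely: an increasing family of ideals `Q W` starting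
at `𝔪 C`, each obtained from the previous ones by adding a regular element of `K`, is reached by
a formally flat ideal contained in `K`. -/
theorem exists_isFormallyFlat_sup_eq {A C : Type*} [CommRing A] [IsNoetherianRing A]
    [IsLocalRing A] [CommRing C] [Algebra A C] [Module.Flat A C] {σ : Type*} (K : Ideal C)
    (Q : Set σ → Ideal C) (hempty : Q ∅ = (maximalIdeal A).map (algebraMap A C))
    (hunion : ∀ 𝒲 : Set (Set σ), 𝒲.Nonempty → DirectedOn (· ⊆ ·) 𝒲 →
      Q (⋃₀ 𝒲) = sSup (Q '' 𝒲))
    (hinsert : ∀ W s, Q (insert s W) = Q W ∨ ∃ F ∈ K, (∀ c, F * c ∈ Q W → c ∈ Q W) ∧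
      Q (insert s W) = Q W ⊔ span {F}) :
    ∃ J ≤ K, IsFormallyFlat A J ∧ J ⊔ (maximalIdeal A).map (algebraMap A C) = Q Set.univ := by
  let M := (maximalIdeal A).map (algebraMap A C)
  let 𝒵 : Set (Set σ × Ideal C) := {z | z.2 ≤ K ∧ IsFormallyFlat A z.2 ∧ z.2 ⊔ M = Q z.1}
  have hstart : ((∅, ⊥) : Set σ × Ideal C) ∈ 𝒵 :=
    ⟨bot_le, isFormallyFlat_bot_of_flat, by rw [hempty]; exact bot_sup_eq M⟩
  have hchain : ∀ c ⊆ 𝒵, IsChain (· ≤ ·) c → ∀ y ∈ c, ∃ ub ∈ 𝒵, ∀ z ∈ c, z ≤ ub := by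
    intro c hc hchain y hy
    have hd := hchain.directedOn
    have hc' : ∀ z ∈ c, z.2 ≤ K ∧ IsFormallyFlat A z.2 ∧ z.2 ⊔ M = Q z.1 := fun z hz => hc hz
    have hQ : ∀ z ∈ c, Q z.1 ≤ sSup (Q '' (Prod.fst '' c)) := fun z hz =>
      le_sSup (Set.mem_image_of_mem _ (Set.mem_image_of_mem _ hz))
    have hJ : ∀ z ∈ c, z.2 ≤ sSup (Prod.snd '' c) := fun z hz =>
      le_sSup (Set.mem_image_of_mem _ hz)
    refine ⟨(⋃₀ (Prod.fst '' c), sSup (Prod.snd '' c)), ⟨?_, ?_, ?_⟩, fun z hz =>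
      ⟨Set.subset_sUnion_of_mem (Set.mem_image_of_mem _ hz), hJ z hz⟩⟩
    · refine sSup_le ?_
      rintro _ ⟨z, hz, rfl⟩
      exact (hc' z hz).1
    · refine isFormallyFlat_sSup ⟨_, Set.mem_image_of_mem _ hy⟩ hd.snd ?_
      rintro _ ⟨z, hz, rfl⟩
      exact (hc' z hz).2.1
    · simp only
      rw [hunion _ ⟨_, Set.mem_image_of_mem _ hy⟩ hd.fst]
      refine le_antisymm (sup_le (sSup_le ?_) ?_) (sSup_le ?_)
      · rintro _ ⟨z, hz, rfl⟩
        exact (le_sup_left.trans (hc' z hz).2.2.le).trans (hQ z hz)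
      · exact (le_sup_right.trans (hc' y hy).2.2.le).trans (hQ y hy)
      · rintro _ ⟨_, ⟨z, hz, rfl⟩, rfl⟩
        exact (hc' z hz).2.2.ge.trans (sup_le_sup_right (hJ z hz) _)
  have hstep : ∀ W J s, (W, J) ∈ 𝒵 → ∃ J' ≥ J, (insert s W, J') ∈ 𝒵 := by
    rintro W J s ⟨hJ, hflat, hJW⟩
    rcases hinsert W s with h | ⟨F, hF, hreg, h⟩
    · exact ⟨J, le_rfl, hJ, hflat, hJW.trans h.symm⟩
    · refine ⟨J ⊔ span {F}, le_sup_left, sup_le hJ ((Ideal.span_singleton_le_iff_mem _).mpr hF),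
        hflat.sup_span_singleton fun c hc => ?_, ?_⟩
      · exact hJW.ge (hreg c (hJW.le hc))
      · rw [sup_right_comm, hJW, h]
  obtain ⟨⟨W, J⟩, -, hmax⟩ := zorn_le_nonempty₀ 𝒵 hchain _ hstart
  obtain rfl : W = Set.univ := by
    refine Set.eq_univ_of_forall fun s => ?_
    obtain ⟨J', hJJ', hJ'⟩ := hstep W J s hmax.prop
    exact (hmax.le_of_ge hJ' ⟨Set.subset_insert s W, hJJ'⟩).1 (Set.mem_insert s W)
  exact ⟨J, hmax.prop⟩

theorem exists_isFormallyFlat_sup_eq_maximalIdeal {A S σ C : Type*} [CommRing A]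
    [IsNoetherianRing A] [IsLocalRing A] [CommRing S] [IsLocalRing S] [Algebra A S]
    (hm : (maximalIdeal A).map (algebraMap A S) = maximalIdeal S)
    [CommRing C] [Algebra A C] [Module.Flat A C] [Algebra (MvPolynomial σ A) C]
    [IsScalarTower A (MvPolynomial σ A) C] (Φ : C →ₐ[A] S) (hΦ : Function.Surjective Φ)
    (q : Ideal (MvPolynomial σ A)) [q.IsPrime]
    (hq : ∀ p, p ∈ q ↔ Φ (algebraMap _ C p) ∈ maximalIdeal S)
    [IsLocalization.AtPrime C q] :
    ∃ J ≤ RingHom.ker Φ, IsFormallyFlat A J ∧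
      J ⊔ (maximalIdeal A).map (algebraMap A C) = q.map (algebraMap _ C) := by
  let π : MvPolynomial σ A →+* ResidueField S :=
    ((residue S).comp Φ.toRingHom).comp (algebraMap _ C)
  have hπ : ∀ p, π p = 0 ↔ p ∈ q := fun p => (residue_eq_zero_iff _).trans (hq p).symm
  have hπq : RingHom.ker π = q := Ideal.ext hπ
  let Q : Set σ → Ideal C := fun W => (relationIdeal π W).map (algebraMap _ C)
  have hdisj : ∀ W, Disjoint (q.primeCompl : Set (MvPolynomial σ A)) (relationIdeal π W) :=
    fun W => Set.disjoint_left.mpr fun p hp hpW =>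
      hp ((hπ p).mp (relationIdeal_le_ker π W hpW))
  have hMC : ((maximalIdeal A).map (algebraMap A C)).map Φ = maximalIdeal S := by
    rw [← hm, ← AlgHom.comp_algebraMap Φ, ← Ideal.map_map]
    rfl
  have hempty : Q ∅ = (maximalIdeal A).map (algebraMap A C) := by
    have h1 : RingHom.ker (π.comp MvPolynomial.C) = maximalIdeal A := by
      have h2 : maximalIdeal A ≤ RingHom.ker (π.comp MvPolynomial.C) := by
        intro a ha
        rw [RingHom.mem_ker, RingHom.comp_apply, hπ, hq, ← hMC, ← MvPolynomial.algebraMap_eq,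
          ← IsScalarTower.algebraMap_apply]
        exact Ideal.mem_map_of_mem _ (Ideal.mem_map_of_mem _ ha)
      exact ((maximalIdeal.isMaximal A).eq_of_le (RingHom.ker_ne_top _) h2).symm
    simp only [Q, relationIdeal_empty, h1, Ideal.map_map]
    rw [IsScalarTower.algebraMap_eq A (MvPolynomial σ A) C, MvPolynomial.algebraMap_eq]
  have huniv : Q Set.univ = q.map (algebraMap _ C) := by
    simp only [Q, relationIdeal_univ, hπq]
  rw [← huniv]
  refine exists_isFormallyFlat_sup_eq _ Q hempty (fun 𝒲 hne hdir => ?_) fun W s => ?_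
  · simp only [Q]
    rw [relationIdeal_sUnion π hne hdir, sSup_image, sSup_image]
    simp only [Ideal.map_iSup]
  obtain ⟨f, hf, hfg⟩ := exists_forall_mul_mem_relationIdeal_sup π W s
  have hQins : Q (insert s W) = Q W ⊔ span {algebraMap _ C f} := by
    refine le_antisymm (Ideal.map_le_iff_le_comap.mpr fun g hg => ?_)
      (sup_le (Ideal.map_mono (relationIdeal_mono π (Set.subset_insert s W))) ?_)
    · obtain ⟨u, hu, hug⟩ := hfg g hg
      have h1 := Ideal.mem_map_of_mem (algebraMap _ C) hug
      rw [Ideal.map_sup, Ideal.map_span, Set.image_singleton, map_mul] at h1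
      have hu' : u ∈ q.primeCompl := fun h => hu ((hπ u).mpr h)
      exact (Ideal.unit_mul_mem_iff_mem _ (IsLocalization.map_units C ⟨u, hu'⟩)).mp h1
    · rw [Ideal.span_singleton_le_iff_mem]
      exact Ideal.mem_map_of_mem _ hf
  by_cases hfW : f ∈ relationIdeal π W
  · left
    rw [hQins, sup_eq_left, Ideal.span_singleton_le_iff_mem]
    exact Ideal.mem_map_of_mem _ hfW
  right
  have hfQ : algebraMap _ C f ∉ Q W := fun h => hfW <| by
    rw [← IsLocalization.under_map_of_isPrime_disjoint q.primeCompl C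
      (isPrime_relationIdeal π W) (hdisj W)]
    exact h
  have hprime : (Q W).IsPrime := IsLocalization.isPrime_of_isPrime_disjoint q.primeCompl C _
    (isPrime_relationIdeal π W) (hdisj W)
  obtain ⟨c, hc, hcf⟩ :
      ∃ c ∈ (maximalIdeal A).map (algebraMap A C), Φ c = Φ (algebraMap _ C f) := by
    refine (Ideal.mem_map_iff_of_surjective Φ hΦ).mp ?_
    rw [hMC, ← hq, ← hπ]
    exact relationIdeal_le_ker π _ hf
  have hcW : c ∈ Q W := by
    rw [← hempty] at hc
    exact Ideal.map_mono (relationIdeal_mono π (Set.empty_subset W)) hc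
  refine ⟨algebraMap _ C f - c, by rw [RingHom.mem_ker, map_sub, hcf, sub_self], fun y hy => ?_, ?_⟩
  · refine (hprime.mem_or_mem ?_).resolve_left hfQ
    have := add_mem hy (Ideal.mul_mem_right y _ hcW)
    rwa [← add_mul, sub_add_cancel] at this
  · rw [hQins]
    refine le_antisymm (sup_le le_sup_left ?_) (sup_le le_sup_left ?_) <;>
      rw [Ideal.span_singleton_le_iff_mem]
    · have := add_mem (Ideal.mem_sup_right (subset_span rfl) :
        algebraMap _ C f - c ∈ Q W ⊔ span {algebraMap _ C f - c}) (Ideal.mem_sup_left hcW)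
      rwa [sub_add_cancel] at this
    · exact sub_mem (Ideal.mem_sup_right (subset_span rfl)) (Ideal.mem_sup_left hcW)

/-- Any local quotient `S` of a polynomial ring over `A` with maximal ideal `𝔪 S` is a quotient of
an `A`-algebra `D` with `𝔪 D` maximal and flat associated graded ring. -/
theorem exists_surjective_isFormallyFlat_bot {A : Type u} {S : Type w} [CommRing A]
    [IsNoetherianRing A] [IsLocalRing A] [CommRing S] [IsLocalRing S] [Algebra A S]
    (hm : (maximalIdeal A).map (algebraMap A S) = maximalIdeal S)
    {σ : Type v} (φ : MvPolynomial σ A →ₐ[A] S) (hφ : Function.Surjective φ) :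
    ∃ (D : Type (max u v)) (_ : CommRing D) (_ : Algebra A D) (Φ : D →ₐ[A] S),
      Function.Surjective Φ ∧ IsFormallyFlat A (⊥ : Ideal D) ∧
        ((maximalIdeal A).map (algebraMap A D)).IsMaximal := by
  let q : Ideal (MvPolynomial σ A) := (maximalIdeal S).comap φ
  let C := Localization.AtPrime q
  have hunit : ∀ y : q.primeCompl, IsUnit (φ y) := fun y => not_not.mp fun h =>
    y.2 ((mem_maximalIdeal _).mpr h)
  let Φ : C →ₐ[A] S := IsLocalization.liftAlgHom (M := q.primeCompl) (f := φ) hunit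
  have hΦ : ∀ p, Φ (algebraMap _ _ p) = φ p := fun p => IsLocalization.lift_eq _ _
  have hΦs : Function.Surjective Φ := fun s => (hφ s).imp' (algebraMap _ _) fun p hp =>
    (hΦ p).trans hp
  have : Module.Flat (MvPolynomial σ A) C := IsLocalization.flat _ q.primeCompl
  have : Module.Flat A C := Module.Flat.trans A (MvPolynomial σ A) _
  obtain ⟨J, hJ, hflat, hJq⟩ := exists_isFormallyFlat_sup_eq_maximalIdeal hm Φ hΦs q
    (fun p => by rw [hΦ]; rfl)
  rw [Localization.AtPrime.map_eq_maximalIdeal] at hJq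
  have hmap : (maximalIdeal A).map (algebraMap A (C ⧸ J)) =
      ((maximalIdeal A).map (algebraMap A C)).map (Ideal.Quotient.mk J) := by
    rw [Ideal.map_map]
    rfl
  refine ⟨C ⧸ J, inferInstance, inferInstance, Ideal.Quotient.liftₐ J Φ hJ,
    Ideal.Quotient.lift_surjective_of_surjective _ _ hΦs,
    hflat.of_algHom (Ideal.Quotient.mkₐ A J) (fun n x hx => ?_) (fun b => ?_) ?_, ?_⟩
  · rw [hmap, ← Ideal.map_pow] at hx
    have := (Ideal.mem_quotient_iff_mem_sup (I := J)).mp hx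
    rwa [sup_comm] at this
  · obtain ⟨x, rfl⟩ := Ideal.Quotient.mk_surjective b
    exact ⟨x, by simp⟩
  · exact fun x hx => Ideal.Quotient.eq_zero_iff_mem.mpr hx
  · have h1 : (maximalIdeal A).map (algebraMap A (C ⧸ J)) =
        (maximalIdeal C).map (Ideal.Quotient.mk J) := by
      rw [hmap, ← hJq, Ideal.map_sup, Ideal.map_quotient_self, bot_sup_eq]
    rw [h1]
    refine Ideal.IsMaximal.map_of_surjective_of_ker_le Ideal.Quotient.mk_surjective ?_
    rw [Ideal.mk_ker, ← hJq]
    exact le_sup_left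

end Presentation

section Completion

/-- Completing at `𝔪`: an algebra with `𝔪 D` maximal and flat associated graded ring, mapping onto
a complete local ring `S`, may be replaced by an `𝔪`-adically complete one. -/
theorem exists_isAdicComplete_isFormallyFlat_bot {A : Type u} {S : Type w} {D : Type v}
    [CommRing A] [IsNoetherianRing A] [IsLocalRing A] [CommRing S] [IsLocalRing S] [Algebra A S]
    (hm : (maximalIdeal A).map (algebraMap A S) = maximalIdeal S)
    [IsAdicComplete (maximalIdeal S) S] [CommRing D] [Algebra A D] (Φ : D →ₐ[A] S)
    (hΦ : Function.Surjective Φ) (hD : IsFormallyFlat A (⊥ : Ideal D))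
    (hmax : ((maximalIdeal A).map (algebraMap A D)).IsMaximal) :
    ∃ (B : Type v) (_ : CommRing B) (_ : Algebra A B) (ψ : B →ₐ[A] S),
      Function.Surjective ψ ∧ IsFormallyFlat A (⊥ : Ideal B) ∧
        ((maximalIdeal A).map (algebraMap A B)).IsMaximal ∧
        IsAdicComplete ((maximalIdeal A).map (algebraMap A B)) B := by
  let I := (maximalIdeal A).map (algebraMap A D)
  have hI : I.FG := Ideal.FG.map (IsNoetherian.noetherian _) _
  let B := AdicCompletion I D
  have htower : (algebraMap D B).comp (algebraMap A D) = algebraMap A B := rfl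
  have hmap : (maximalIdeal A).map (algebraMap A B) = I.map (algebraMap D B) := by
    rw [Ideal.map_map, htower]
  have hcomplete := AdicCompletion.isAdicComplete_self I hI
  have hmaxB := AdicCompletion.isMaximal_map_of_le I I le_rfl hI
  have hmem : ∀ n (x : B), x ∈ I.map (algebraMap D B) ^ n ↔ AdicCompletion.evalₐ I n x = 0 := by
    intro n x
    have h1 : x ∈ I.map (algebraMap D B) ^ n ↔ x ∈ (I ^ n • ⊤ : Submodule D B) := by
      rw [Ideal.smul_top_eq_map, Ideal.map_pow]
      rfl
    rw [h1, AdicCompletion.pow_smul_top_eq_ker_eval hI, LinearMap.mem_ker]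
    constructor <;> intro h
    · rw [← AdicCompletion.factor_eval_eq_evalₐ I x (by simp), h, map_zero]
    · rw [← AdicCompletion.factor_evalₐ_eq_eval I x (by simp), h, map_zero]
  have heval : ∀ n d, AdicCompletion.evalₐ I n (algebraMap D B d) = Ideal.Quotient.mk _ d :=
    AdicCompletion.evalₐ_of I
  have hle : ∀ n, I ^ n ≤ (maximalIdeal S ^ n).comap Φ := by
    intro n
    rw [← hm, ← Ideal.map_le_iff_le_comap, Ideal.map_pow, ← Φ.comp_algebraMap, ← Ideal.map_map]
    rfl
  let Ψ : ∀ n, B →+* S ⧸ maximalIdeal S ^ n := fun n =>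
    (Ideal.quotientMap _ Φ.toRingHom (hle n)).comp (AdicCompletion.evalₐ I n).toRingHom
  have hΨ : ∀ {m n : ℕ} (h : m ≤ n),
      (Ideal.Quotient.factorPow (maximalIdeal S) h).comp (Ψ n) = Ψ m := by
    intro m n h
    ext x
    obtain ⟨d, hd⟩ := Ideal.Quotient.mk_surjective (AdicCompletion.evalₐ I n x)
    have hd' : AdicCompletion.evalₐ I m x = Ideal.Quotient.mk _ d := by
      rw [← heval, ← sub_eq_zero, ← map_sub, ← hmem]
      refine Ideal.pow_le_pow_right h ((hmem _ _).mpr ?_)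
      rw [map_sub, heval, hd, sub_self]
    simp [Ψ, ← hd, hd']
  let ψ := IsAdicComplete.liftRingHom (maximalIdeal S) Ψ hΨ
  have hψ : ∀ d, ψ (algebraMap D B d) = Φ d := by
    intro d
    refine sub_eq_zero.mp (IsHausdorff.haus (I := maximalIdeal S) inferInstance _ fun n => ?_)
    rw [SModEq.zero, smul_eq_mul, Ideal.mul_top, ← Ideal.Quotient.eq_zero_iff_mem, map_sub,
      IsAdicComplete.mk_liftRingHom, sub_eq_zero]
    simp [Ψ, heval]
  refine ⟨B, inferInstance, inferInstance, ⟨ψ, fun a => ?_⟩, fun s => ?_,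
    hD.of_algHom (B := B) ⟨algebraMap D B, fun a => rfl⟩ (fun n x hx => ?_) (fun b => ?_) bot_le,
    hmap ▸ hmaxB, hmap ▸ hcomplete⟩
  · rw [← htower]
    exact (hψ _).trans (Φ.commutes a)
  · obtain ⟨d, rfl⟩ := hΦ s
    exact ⟨_, hψ d⟩
  · rw [hmap, hmem] at hx
    rw [bot_sup_eq]
    exact Ideal.Quotient.eq_zero_iff_mem.mp ((heval n x).symm.trans hx)
  · obtain ⟨x, hx⟩ := Ideal.Quotient.mk_surjective (AdicCompletion.evalₐ I 1 b)
    refine ⟨x, ?_⟩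
    rw [hmap, ← pow_one (I.map _), hmem, map_sub, ← hx, sub_eq_zero]
    exact (heval 1 x).symm

end Completion

theorem ker_le_map_ker {A R S B : Type*} [CommRing A] [IsNoetherianRing A] [IsLocalRing A]
    [CommRing R] [CommRing S] [CommRing B] [IsNoetherianRing B] [Algebra A R] [Algebra R S]
    [Algebra A S] [IsScalarTower A R S] [Algebra A B] [Module.Flat R S]
    (hR : Function.Surjective (algebraMap A R)) (ψ : B →ₐ[A] S) (hψ : Function.Surjective ψ)
    (hjac : (maximalIdeal A).map (algebraMap A B) ≤ jacobson ⊥)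
    (hker : RingHom.ker ψ ≤ (maximalIdeal A).map (algebraMap A B)) :
    RingHom.ker ψ ≤ (RingHom.ker (algebraMap A R)).map (algebraMap A B) := by
  refine Submodule.le_of_le_smul_of_le_jacobson_bot (IsNoetherian.noetherian _) hjac ?_
  intro y hy
  obtain ⟨k, x, hx⟩ := Submodule.fg_iff_exists_fin_generating_family.mp
    (IsNoetherian.noetherian (maximalIdeal A))
  obtain ⟨b, rfl⟩ := (mem_map_iff_exists_sum hx).mp (hker hy)
  obtain ⟨l, a, s, hs, ha⟩ := Module.Flat.isTrivialRelation_of_sum_smul_eq_zero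
    (f := fun i ↦ algebraMap A R (x i)) (x := fun i ↦ ψ (b i))
    (by simpa [Algebra.smul_def, ← IsScalarTower.algebraMap_apply] using hy)
  choose α hα using fun i j ↦ hR (a i j)
  choose t ht using fun j ↦ hψ (s j)
  have key : ∑ i, algebraMap A B (x i) * b i =
      ∑ j, algebraMap A B (∑ i, x i * α i j) * t j +
        ∑ i, algebraMap A B (x i) * (b i - ∑ j, algebraMap A B (α i j) * t j) := by
    simp only [map_sum, map_mul, Finset.sum_mul, mul_sub, Finset.sum_sub_distrib, Finset.mul_sum]
    rw [Finset.sum_comm]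
    simp only [mul_assoc]
    ring
  rw [key]
  refine Submodule.add_mem_sup (sum_mem fun j _ ↦ mul_mem_right _ _ (mem_map_of_mem _ ?_))
    (sum_mem fun i _ ↦ Submodule.smul_mem_smul (mem_map_of_mem _ ?_) ?_)
  · simpa [RingHom.mem_ker, hα] using ha j
  · exact hx ▸ subset_span ⟨i, rfl⟩
  · simp [RingHom.mem_ker, hs, ht, ← hα, Algebra.smul_def, ← IsScalarTower.algebraMap_apply]

/-- If the kernel of `ψ : B → S` is generated by the kernel of `A → R`, then `ψ` induces an
isomorphism `B ⊗[A] R ≃ S`. -/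
theorem exists_tensorProduct_ringEquiv {A R S B : Type*} [CommRing A] [CommRing R] [CommRing S]
    [CommRing B] [Algebra A R] [Algebra R S] [Algebra A S] [IsScalarTower A R S] [Algebra A B]
    (hR : Function.Surjective (algebraMap A R)) (ψ : B →ₐ[A] S) (hψ : Function.Surjective ψ)
    (hker : RingHom.ker ψ ≤ (RingHom.ker (algebraMap A R)).map (algebraMap A B)) :
    ∃ e : B ⊗[A] R ≃+* S, ∀ r : R, e (1 ⊗ₜ[A] r) = algebraMap R S r := by
  let e := Algebra.TensorProduct.productMap ψ (IsScalarTower.toAlgHom A R S)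
  have hzero (b : B) (hb : b ∈ (RingHom.ker (algebraMap A R)).map (algebraMap A B)) :
      b ⊗ₜ[A] (1 : R) = 0 := by
    suffices (RingHom.ker (algebraMap A R)).map (algebraMap A B) ≤
        RingHom.ker (Algebra.TensorProduct.includeLeft : B →ₐ[A] B ⊗[A] R) from this hb
    rw [Ideal.map_le_iff_le_comap]
    intro a ha
    rw [RingHom.mem_ker] at ha
    simp only [mem_comap, RingHom.mem_ker, Algebra.TensorProduct.includeLeft_apply]
    rw [Algebra.algebraMap_eq_smul_one, TensorProduct.smul_tmul, ← Algebra.algebraMap_eq_smul_one,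
      ha, TensorProduct.tmul_zero]
  have hpure (z : B ⊗[A] R) : ∃ b : B, z = b ⊗ₜ[A] 1 := by
    induction z with
    | zero => exact ⟨0, by simp⟩
    | tmul b r =>
      obtain ⟨a, rfl⟩ := hR r
      exact ⟨a • b, by rw [Algebra.algebraMap_eq_smul_one, TensorProduct.smul_tmul]⟩
    | add y z hy hz =>
      obtain ⟨b, rfl⟩ := hy
      obtain ⟨c, rfl⟩ := hz
      exact ⟨b + c, (TensorProduct.add_tmul _ _ _).symm⟩
  refine ⟨RingEquiv.ofBijective e ⟨(injective_iff_map_eq_zero e).mpr fun z hz ↦ ?_, fun s ↦ ?_⟩,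
    fun r ↦ (RingEquiv.ofBijective_apply _ _ _).trans (by simp [e])⟩
  · obtain ⟨b, rfl⟩ := hpure z
    exact hzero b (hker (by simpa [e, RingHom.mem_ker] using hz))
  · obtain ⟨b, rfl⟩ := hψ s
    exact ⟨b ⊗ₜ 1, by simp [e]⟩

/-- lifting of scalar extensions: if `A → R` is a surjective local homomorphism
of Noetherian local rings and `R → S` is a scalar extension with `S` complete, then there is a
scalar extension `A → B` whose base change `B ⊗_A R` is isomorphic to `S` as an `R`-algebra. -/
theorem lift_scalarExtension
    {A : Type u} {R : Type v} {S : Type w} [CommRing A] [CommRing R] [CommRing S]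
    [IsNoetherianRing A] [IsNoetherianRing R] [IsNoetherianRing S]
    [IsLocalRing A] [IsLocalRing R] [IsLocalRing S]
    (g : A →+* R) (hgsurj : Function.Surjective g) (hgloc : IsLocalHom g)
    (f : R →+* S) (hfloc : IsLocalHom f) (hf : IsScalarExtension f)
    (hS : IsAdicComplete (maximalIdeal S) S) :
    ∃ (B : Type (max u v w)) (_ : CommRing B) (_ : IsNoetherianRing B) (_ : IsLocalRing B)
      (h : A →+* B) (_ : IsLocalHom h), IsScalarExtension h ∧
      (letI : Algebra A B := h.toAlgebra
       letI : Algebra A R := g.toAlgebra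
       ∃ e : TensorProduct A B R ≃+* S, ∀ r : R, e (1 ⊗ₜ[A] r) = f r) := by
  let _ : Algebra A R := g.toAlgebra
  let _ : Algebra R S := f.toAlgebra
  let _ : Algebra A S := (f.comp g).toAlgebra
  have : IsScalarTower A R S := .of_algebraMap_eq fun _ ↦ rfl
  have : Module.FaithfullyFlat R S := hf.1
  have hm : (maximalIdeal A).map (algebraMap A S) = maximalIdeal S := by
    have hcomap : (maximalIdeal R).comap g = maximalIdeal A := ((local_hom_TFAE g).out 0 4).mp hgloc
    rw [← hf.2, ← hcomap]
    nth_rw 2 [← Ideal.map_comap_of_surjective g hgsurj (maximalIdeal R)]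
    rw [Ideal.map_map]
    rfl
  let φ : MvPolynomial (ULift.{v} S) A →ₐ[A] S := MvPolynomial.aeval ULift.down
  have hφ : Function.Surjective φ := fun s ↦ ⟨.X ⟨s⟩, by simp [φ]⟩
  obtain ⟨D, _, _, Φ, hΦ, hD, hmaxD⟩ := exists_surjective_isFormallyFlat_bot hm φ hφ
  obtain ⟨B, _, algB, ψ, hψ, hB, hmax, hcomp⟩ :=
    exists_isAdicComplete_isFormallyFlat_bot hm Φ hΦ hD hmaxD
  have : IsLocalRing B := 
    isLocalRing_of_isAdicComplete_maximal ((maximalIdeal A).map (algebraMap A B))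
  have hmB := IsLocalRing.eq_maximalIdeal hmax
  let _ := Ideal.Quotient.field ((maximalIdeal A).map (algebraMap A B))
  have : IsNoetherianRing B := isNoetherianRing_of_isAdicComplete
    ((maximalIdeal A).map (algebraMap A B)) (.map (IsNoetherian.noetherian _) _)
  have : Module.Flat A B := hB.flat hmax.ne_top
  have hloc : IsLocalHom (algebraMap A B) := ((local_hom_TFAE _).out 0 2).mpr hmB.le
  have : Module.FaithfullyFlat A B := .of_flat_of_isLocalHom
  have halg : (algebraMap A B).toAlgebra = algB := Algebra.algebra_ext _ _ fun _ ↦ rfl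
  have hker : RingHom.ker ψ ≤ (maximalIdeal A).map (algebraMap A B) :=
    hmB ▸ le_maximalIdeal (RingHom.ker_ne_top ψ)
  have hker' := ker_le_map_ker hgsurj ψ hψ (IsAdicComplete.le_jacobson_bot _) hker
  refine ⟨B, _, ‹_›, ‹_›, algebraMap A B, hloc, ⟨?_, hmB⟩, ?_⟩
  · rwa [halg]
  · rw [halg]
    exact exists_tensorProduct_ringEquiv hgsurj ψ hψ hker'
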